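/- arXiv:1409.3210 — 4 statements merged into one kernel-verified Lean document; each statement's English description precedes it below -/
import Mathlib

section
/- Let G be a group, H a subgroup of G, and T ⊆ G a right transversal of H in G (i.e., G is the disjoint union of the right cosets Ht for t ∈ T). Then there exists a group homomorphism φ : G → H ≀ Sym(T) into the wreath product such that for every g ∈ G and every σ ∈ Sym(T) and tuple (h_t)_{t∈T} ∈ H^T, one has φ(g) = ((h_t)_{t∈T}, σ) if and only if for all t ∈ T: H·(tσ) = H·(tg) and t·g = h_{tσ}·(tσ) as elements of G. -/
/-- The wreath product `H ≀ Sym(T)`: the semidirect product of `Sym(T)` with `H^T`, where a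
permutation `σ` acts on a tuple `(h_t)_{t∈T}` by `((h_t)_{t∈T})^σ = (h_{tσ⁻¹})_{t∈T}`.
(Conventions are for *right* actions: the element `⟨h, σ⟩` stands for `σ·(h_t)_{t∈T}`, the
permutation `σ` applied to `t` is written `σ t`, and permutations compose so that
`(σ₁ * σ₂) t = σ₂ (σ₁ t)` corresponds to "first `σ₁`, then `σ₂`".) -/
@[ext]
structure Wreath (H : Type*) (T : Type*) where
  toFun : T → H
  perm : Equiv.Perm T

namespace Wreath

variable {H T : Type*} [Group H]

instance : Mul (Wreath H T) :=
  ⟨fun a b => ⟨fun t => a.toFun (b.perm⁻¹ t) * b.toFun t, b.perm * a.perm⟩⟩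

instance : One (Wreath H T) := ⟨⟨fun _ => 1, 1⟩⟩

instance : Inv (Wreath H T) :=
  ⟨fun a => ⟨fun t => (a.toFun (a.perm t))⁻¹, a.perm⁻¹⟩⟩

@[simp] lemma mul_toFun (a b : Wreath H T) (t : T) :
    (a * b).toFun t = a.toFun (b.perm⁻¹ t) * b.toFun t := rfl

@[simp] lemma mul_perm (a b : Wreath H T) : (a * b).perm = b.perm * a.perm := rfl

@[simp] lemma one_toFun (t : T) : (1 : Wreath H T).toFun t = 1 := rfl

@[simp] lemma one_perm : (1 : Wreath H T).perm = 1 := rfl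

@[simp] lemma inv_toFun (a : Wreath H T) (t : T) :
    (a⁻¹).toFun t = (a.toFun (a.perm t))⁻¹ := rfl

@[simp] lemma inv_perm (a : Wreath H T) : (a⁻¹).perm = a.perm⁻¹ := rfl

instance : Group (Wreath H T) where
  mul_assoc a b c := by
    refine Wreath.ext (funext fun t => ?_) ?_
    · simp [mul_assoc]
    · simp [mul_assoc]
  one_mul a := by
    refine Wreath.ext (funext fun t => ?_) ?_ <;> simp
  mul_one a := by
    refine Wreath.ext (funext fun t => ?_) ?_ <;> simp
  inv_mul_cancel a := by
    refine Wreath.ext (funext fun t => ?_) ?_ <;> simp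

end Wreath

namespace Wreath

/-- The element `x` of the wreath product describes right multiplication by `g` on the
transversal `T`. -/
def Represents {G : Type*} [Group G] {H : Subgroup G} {T : Set G} (g : G) (x : Wreath H T) : Prop :=
  ∀ t : T, (t : G) * g = (x.toFun (x.perm t) : G) * (x.perm t : G)

variable {G : Type*} [Group G] {H : Subgroup G} {T : Set G}

lemma Represents.mul {g₁ g₂ : G} {x₁ x₂ : Wreath H T} (h₁ : Represents g₁ x₁)
    (h₂ : Represents g₂ x₂) : Represents (g₁ * g₂) (x₁ * x₂) := by
  intro t
  simp [← mul_assoc, h₁ t]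
  simp [mul_assoc, h₂ (x₁.perm t)]

lemma Represents.mul_inv_mem {g : G} {x : Wreath H T} (hx : Represents g x) (t : T) :
    (t : G) * g * (x.perm t : G)⁻¹ ∈ H := by
  simp [hx t]

lemma Represents.unique (hT : ∀ g : G, ∃! t : T, g * (t : G)⁻¹ ∈ H) {g : G} {x y : Wreath H T}
    (hx : Represents g x) (hy : Represents g y) : x = y := by
  have hperm : x.perm = y.perm :=
    Equiv.ext fun t => (hT (t * g)).unique (hx.mul_inv_mem t) (hy.mul_inv_mem t)
  refine Wreath.ext (funext fun s => ?_) hperm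
  obtain ⟨t, rfl⟩ := x.perm.surjective s
  have h := (hx t).symm.trans (hy t)
  rw [← hperm] at h
  exact Subtype.ext (mul_right_cancel h)

lemma exists_represents (hT : ∀ g : G, ∃! t : T, g * (t : G)⁻¹ ∈ H) (g : G) :
    ∃ x : Wreath H T, Represents g x := by
  choose rep hrep huniq using hT
  have rep_rep (g : G) (t : T) : rep (rep (t * g) * g⁻¹) = t := by
    refine (huniq _ t ?_).symm
    simpa [mul_assoc] using H.inv_mem (hrep (t * g))
  let σ : Equiv.Perm T :=
    { toFun t := rep (t * g)
      invFun t := rep (t * g⁻¹)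
      left_inv := rep_rep g
      right_inv t := by simpa using rep_rep g⁻¹ t }
  have mem (s : T) : (σ.symm s : G) * g * (s : G)⁻¹ ∈ H := by
    have h : (σ.symm s : G) * g * (σ (σ.symm s) : G)⁻¹ ∈ H := hrep _
    rwa [σ.apply_symm_apply] at h
  exact ⟨⟨fun s => ⟨_, mem s⟩, σ⟩, fun t => by simp⟩

end Wreath

/-- Let `G` be a group, `H ≤ G` and `T ⊆ G` a right transversal of `H` in `G`
(every `g ∈ G` lies in exactly one coset `Ht`, `t ∈ T`).  Then there is a group homomorphism
`φ : G → H ≀ Sym(T)` such that for all `g`, `σ` and `(h_t)_{t∈T}` one has `φ g = ((h_t)_t, σ)`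
if and only if for all `t ∈ T`: `H·(tσ) = H·(tg)` and `t·g = h_{tσ}·(tσ)` in `G`. -/
theorem stmt0 {G : Type*} [Group G] (H : Subgroup G) (T : Set G)
    (hT : ∀ g : G, ∃! t : T, g * (t : G)⁻¹ ∈ H) :
    ∃ φ : G →* Wreath ↥H ↥T,
      ∀ (g : G) (h : ↥T → ↥H) (σ : Equiv.Perm ↥T),
        φ g = ⟨h, σ⟩ ↔
          ∀ t : ↥T, ((t : G) * g) * ((σ t : G))⁻¹ ∈ H ∧
            (t : G) * g = ((h (σ t) : G)) * (σ t : G) := by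
  choose f hf using Wreath.exists_represents hT
  refine ⟨MonoidHom.mk' f fun a b => (hf (a * b)).unique hT ((hf a).mul (hf b)), fun g h σ => ?_⟩
  constructor
  · intro (hg : f g = ⟨h, σ⟩) t
    have hx := hf g
    rw [hg] at hx
    exact ⟨hx.mul_inv_mem t, hx t⟩
  · exact fun hx => (hf g).unique hT fun t => (hx t).2
end

section
/- Let 1 → M → Ĥ →^κ H → 1 be an exact sequence of groups (κ a surjective homomorphism with kernel M), let H be a subgroup of a group G with right transversal T, and let φ : G → H ≀ Sym(T) be a homomorphism as in the wreath-product coset lemma. Let κ≀1 : Ĥ ≀ Sym(T) → H ≀ Sym(T) be the homomorphism applying κ componentwise, ((x_t)_{t∈T}, σ) ↦ ((κ(x_t))_{t∈T}, σ), and let Ĝ := {(x, g) ∈ (Ĥ ≀ Sym(T)) × G : (κ≀1)(x) = φ(g)} be the pullback. Then the projection κ^{⊗G} : Ĝ → G, (x,g) ↦ g, is a surjective group homomorphism, and its kernel equals {(((m_t)_{t∈T}, id), 1) : m_t ∈ M for all t}, which is isomorphic as a group to the direct product M^T (the group of functions T → M under pointwise multiplication). -/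
namespace Wreath

variable {H T : Type*} [Group H]

/-- The homomorphism `κ ≀ 1 : Hhat ≀ Sym(T) → H ≀ Sym(T)` applying `κ` componentwise,
`((x_t)_{t∈T}, σ) ↦ ((κ x_t)_{t∈T}, σ)`. -/
def map {H' : Type*} [Group H'] (κ : H →* H') : Wreath H T →* Wreath H' T where
  toFun a := ⟨fun t => κ (a.toFun t), a.perm⟩
  map_one' := by
    refine Wreath.ext (funext fun t => ?_) rfl
    simp
  map_mul' a b := by
    refine Wreath.ext (funext fun t => ?_) rfl
    simp

end Wreath

/-- The pullback (fibered product) of two group homomorphisms `κ₁ : G₁ →* G` and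
`κ₂ : G₂ →* G`, as a subgroup of the direct product `G₁ × G₂`. -/
def MonoidHom.pullback {G₁ G₂ G : Type*} [Group G₁] [Group G₂] [Group G]
    (κ₁ : G₁ →* G) (κ₂ : G₂ →* G) : Subgroup (G₁ × G₂) where
  carrier := {p | κ₁ p.1 = κ₂ p.2}
  one_mem' := by simp
  mul_mem' := by
    intro a b ha hb
    simp only [Set.mem_setOf_eq, Prod.fst_mul, Prod.snd_mul, map_mul] at *
    rw [ha, hb]
  inv_mem' := by
    intro a ha
    simp only [Set.mem_setOf_eq, Prod.fst_inv, Prod.snd_inv, map_inv] at *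
    rw [ha]

namespace Wreath

variable {H H' T : Type*} [Group H] [Group H']

lemma map_surjective {κ : H →* H'} (hκ : Function.Surjective κ) :
    Function.Surjective (map (T := T) κ) := fun a =>
  ⟨⟨fun t => Function.surjInv hκ (a.toFun t), a.perm⟩,
    Wreath.ext (funext fun t => Function.surjInv_eq hκ (a.toFun t)) rfl⟩

lemma mem_ker_map {κ : H →* H'} {a : Wreath H T} :
    a ∈ (map κ).ker ↔ (∀ t, a.toFun t ∈ κ.ker) ∧ a.perm = 1 := by
  rw [MonoidHom.mem_ker, Wreath.ext_iff, funext_iff]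
  rfl

/-- The kernel of `κ ≀ 1` is the direct power of the kernel of `κ`. -/
def kerMapEquiv (κ : H →* H') : (map (T := T) κ).ker ≃* (T → κ.ker) where
  toFun a t := ⟨a.1.toFun t, (mem_ker_map.1 a.2).1 t⟩
  invFun m := ⟨⟨fun t => m t, 1⟩, mem_ker_map.2 ⟨fun t => (m t).2, rfl⟩⟩
  left_inv a := Subtype.ext (Wreath.ext rfl (mem_ker_map.1 a.2).2.symm)
  right_inv _ := rfl
  map_mul' a b := by
    ext t
    simp [(mem_ker_map.1 b.2).2]

end Wreath

namespace MonoidHom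

variable {G₁ G₂ G : Type*} [Group G₁] [Group G₂] [Group G]

/-- The projection of a pullback onto its second factor. -/
def pullbackSnd (κ₁ : G₁ →* G) (κ₂ : G₂ →* G) : pullback κ₁ κ₂ →* G₂ :=
  (MonoidHom.snd G₁ G₂).comp (pullback κ₁ κ₂).subtype

variable {κ₁ : G₁ →* G} {κ₂ : G₂ →* G}

lemma pullbackSnd_surjective (h : Function.Surjective κ₁) :
    Function.Surjective (pullbackSnd κ₁ κ₂) := fun g =>
  let ⟨x, hx⟩ := h (κ₂ g)
  ⟨⟨(x, g), hx⟩, rfl⟩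

lemma fst_mem_ker_of_mem_ker_pullbackSnd {p : pullback κ₁ κ₂}
    (hp : p ∈ (pullbackSnd κ₁ κ₂).ker) : p.1.1 ∈ κ₁.ker := by
  have h₁ : κ₁ p.1.1 = κ₂ p.1.2 := p.2
  have h₂ : p.1.2 = 1 := hp
  rw [mem_ker, h₁, h₂, map_one]

/-- The kernel of the second projection of a pullback is the kernel of the first map. -/
def kerPullbackSndEquiv (κ₁ : G₁ →* G) (κ₂ : G₂ →* G) :
    (pullbackSnd κ₁ κ₂).ker ≃* κ₁.ker where
  toFun p := ⟨p.1.1.1, fst_mem_ker_of_mem_ker_pullbackSnd p.2⟩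
  invFun x := ⟨⟨(x, 1), x.2.trans (map_one κ₂).symm⟩, rfl⟩
  left_inv p := Subtype.ext (Subtype.ext (Prod.ext rfl p.2.symm))
  right_inv _ := rfl
  map_mul' _ _ := rfl

end MonoidHom

/-- Let `1 → M → Hhat →^κ H → 1` be exact, `H ≤ G` with right transversal `T`,
and `φ : G → H ≀ Sym(T)` a homomorphism as in the wreath-product coset lemma.  Let
`κ≀1 : Hhat ≀ Sym(T) → H ≀ Sym(T)` be componentwise application of `κ` and let
`Ĝ = {(x, g) : (κ≀1) x = φ g}` be the pullback.  Then the projection `κ^{⊗G} : Ĝ → G` is a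
surjective group homomorphism whose kernel is `{(((m_t)_t, id), 1) : m_t ∈ M}`, which is
isomorphic as a group to the direct product `M^T`. -/
theorem stmt1 {G : Type*} [Group G] (H : Subgroup G) (T : Set G)
    (hT : ∀ g : G, ∃! t : T, g * (t : G)⁻¹ ∈ H)
    {Hhat : Type*} [Group Hhat] (κ : Hhat →* ↥H) (hκ : Function.Surjective κ)
    (φ : G →* Wreath ↥H ↥T)
    (hφ : ∀ (g : G) (h : ↥T → ↥H) (σ : Equiv.Perm ↥T),
      φ g = ⟨h, σ⟩ ↔
        ∀ t : ↥T, ((t : G) * g) * ((σ t : G))⁻¹ ∈ H ∧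
          (t : G) * g = ((h (σ t) : G)) * (σ t : G)) :
    ∃ π : ↥(MonoidHom.pullback (Wreath.map (T := ↥T) κ) φ) →* G,
      (∀ p : ↥(MonoidHom.pullback (Wreath.map (T := ↥T) κ) φ),
        π p = (p : Wreath Hhat ↥T × G).2) ∧
      Function.Surjective π ∧
      (∀ p : ↥(MonoidHom.pullback (Wreath.map (T := ↥T) κ) φ),
        p ∈ π.ker ↔ ∃ m : ↥T → Hhat, (∀ t, m t ∈ κ.ker) ∧
          (p : Wreath Hhat ↥T × G) = (⟨m, 1⟩, 1)) ∧
      Nonempty (↥π.ker ≃* (↥T → ↥κ.ker)) := by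
  refine ⟨MonoidHom.pullbackSnd _ φ, fun _ => rfl,
    MonoidHom.pullbackSnd_surjective (Wreath.map_surjective hκ), fun p => ⟨fun hp => ?_, ?_⟩,
    ⟨(MonoidHom.kerPullbackSndEquiv _ φ).trans (Wreath.kerMapEquiv κ)⟩⟩
  · obtain ⟨hm, hσ⟩ := Wreath.mem_ker_map.1 (MonoidHom.fst_mem_ker_of_mem_ker_pullbackSnd hp)
    exact ⟨p.1.1.toFun, hm, Prod.ext (Wreath.ext rfl hσ) hp⟩
  · rintro ⟨m, -, hp⟩
    exact congrArg Prod.snd hp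
end

section
/- Let F be a field, M a group, T a finite set, and N = M^T the direct product of |T| copies of M (the group of functions T → M). For each t ∈ T let W_t be an F[M]-module whose M-fixed submodule is zero (W_t^M = 0). Let V = ⊕_{t∈T} W_t with N acting coordinatewise: (w_t)_{t∈T} · (m_t)_{t∈T} = (w_t·m_t)_{t∈T}. Then every F[N]-module endomorphism of V maps each summand W_t into itself; consequently the natural map ∏_{t∈T} End_{F[M]}(W_t) → End_{F[N]}(V) (acting diagonally) is an isomorphism of F-algebras. -/
/-- `End_{R[N]}(V)`: the subalgebra of `R`-linear endomorphisms of `V` commuting with each of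
the given operators `ρN n`, `n : N`. -/
def commutant (R : Type*) [CommSemiring R] {V : Type*} [AddCommMonoid V] [Module R V]
    {N : Type*} (ρN : N → Module.End R V) : Subalgebra R (Module.End R V) where
  carrier := {s | ∀ n : N, s * ρN n = ρN n * s}
  mul_mem' := fun {a b} ha hb n => by
    rw [mul_assoc, hb n, ← mul_assoc, ha n, mul_assoc]
  one_mem' := fun n => by rw [one_mul, mul_one]
  add_mem' := fun {a b} ha hb n => by rw [add_mul, mul_add, ha n, hb n]
  zero_mem' := fun n => by rw [zero_mul, mul_zero]
  algebraMap_mem' := fun r n => Algebra.commutes r (ρN n)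

/-- The coordinatewise action of `N = M^T` on `V = ⊕_{t ∈ T} W t`:
`(w_t)_{t∈T} · (m_t)_{t∈T} = (w_t · m_t)_{t∈T}`. -/
def piEnd (F : Type*) [CommSemiring F] {T : Type*} (W : T → Type*)
    [∀ t, AddCommMonoid (W t)] [∀ t, Module F (W t)]
    {M : Type*} [Group M] (ρ : ∀ t, M →* Module.End F (W t)) (m : T → M) :
    Module.End F (∀ t, W t) :=
  LinearMap.pi fun t => (ρ t (m t)) ∘ₗ LinearMap.proj t

section Commutant

variable {F : Type*} [CommSemiring F] {M : Type*} [Group M] {T : Type*}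
  {W : T → Type*} [∀ t, AddCommMonoid (W t)] [∀ t, Module F (W t)]
  {ρ : ∀ t, M →* Module.End F (W t)}

theorem mem_commutant_iff {V N : Type*} [AddCommMonoid V] [Module F V]
    {σ : N → Module.End F V} {s : Module.End F V} :
    s ∈ commutant F σ ↔ ∀ n v, s (σ n v) = σ n (s v) :=
  ⟨fun h n v => LinearMap.congr_fun (h n) v, fun h n => LinearMap.ext (h n)⟩

@[simp]
theorem piEnd_apply (m : T → M) (w : ∀ t, W t) (t : T) :
    piEnd F W ρ m w t = ρ t (m t) (w t) := rfl

variable (ρ) in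
/-- The diagonal map from the product of the commutants of the factors to the commutant of the
coordinatewise action. -/
def commutantDiagonal :
    (∀ t, ↥(commutant F fun m : M => ρ t m)) →ₐ[F]
      ↥(commutant F (fun m : T → M => piEnd F W ρ m)) where
  toFun s := ⟨LinearMap.pi fun t => (s t : Module.End F (W t)) ∘ₗ LinearMap.proj t,
    mem_commutant_iff.2 fun m w => funext fun t => mem_commutant_iff.1 (s t).2 (m t) (w t)⟩
  map_one' := rfl
  map_mul' _ _ := rfl
  map_zero' := rfl
  map_add' _ _ := rfl
  commutes' _ := rfl

theorem commutantDiagonal_apply (s : ∀ t, ↥(commutant F fun m : M => ρ t m))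
    (w : ∀ t, W t) (t : T) :
    (commutantDiagonal ρ s : Module.End F (∀ t, W t)) w t =
      (s t : Module.End F (W t)) (w t) := rfl

variable [DecidableEq T]

theorem commutantDiagonal_injective : Function.Injective (commutantDiagonal ρ) := by
  intro a b h
  funext t
  refine Subtype.ext (LinearMap.ext fun x => ?_)
  have := congrFun (LinearMap.congr_fun (congrArg Subtype.val h) (Pi.single t x)) t
  simpa [commutantDiagonal_apply] using this

/-- An endomorphism commuting with the coordinatewise action preserves each summand. -/
theorem apply_eq_zero_of_mem_commutant_piEnd
    (hfix : ∀ (t : T) (w : W t), (∀ m : M, ρ t m w = w) → w = 0)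
    {s : Module.End F (∀ t, W t)} (hs : s ∈ commutant F (fun m : T → M => piEnd F W ρ m))
    {w : ∀ t, W t} {u : T} (hw : w u = 0) : s w u = 0 := by
  refine hfix u _ fun g => ?_
  have hfixed : piEnd F W ρ (Pi.mulSingle u g) w = w := by
    funext v
    by_cases hv : v = u
    · subst hv
      simp [hw]
    · simp [Pi.mulSingle_eq_of_ne hv]
  have h := congrFun (mem_commutant_iff.1 hs (Pi.mulSingle u g) w) u
  rw [hfixed] at h
  simpa using h.symm

theorem commutantDiagonal_surjective
    (hfix : ∀ (t : T) (w : W t), (∀ m : M, ρ t m w = w) → w = 0) :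
    Function.Surjective (commutantDiagonal ρ) := by
  rintro ⟨s, hs⟩
  refine ⟨fun t => ⟨LinearMap.proj t ∘ₗ s ∘ₗ LinearMap.single F W t,
    mem_commutant_iff.2 fun g x => ?_⟩, Subtype.ext (LinearMap.ext fun w => funext fun t => ?_)⟩
  · have hsingle : piEnd F W ρ (fun _ => g) (Pi.single t x) = Pi.single t (ρ t g x) := by
      funext v
      by_cases hv : v = t
      · subst hv
        simp
      · simp [Pi.single_eq_of_ne hv]
    have h := congrFun (mem_commutant_iff.1 hs (fun _ => g) (Pi.single t x)) t
    rw [hsingle] at h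
    simpa using h
  · have hw : w = Pi.single t (w t) + Function.update w t 0 := by
      funext v
      by_cases hv : v = t
      · subst hv
        simp
      · simp [Pi.single_eq_of_ne hv, Function.update_of_ne hv]
    have h := congrArg (fun v => s v t) hw
    rw [map_add, Pi.add_apply, apply_eq_zero_of_mem_commutant_piEnd hfix hs
      (Function.update_self t 0 w), add_zero] at h
    exact h.symm

end Commutant

set_option synthInstance.maxHeartbeats 1000000 in
set_option maxHeartbeats 1000000 in
/-- Let `F` be a field, `M` a group, `T` a finite set and `N = M^T`.  For each
`t ∈ T` let `W t` be an `F[M]`-module with `(W t)^M = 0`.  Let `V = ⊕_{t∈T} W t` with `N`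
acting coordinatewise.  Then every `F[N]`-endomorphism of `V` maps each summand `W t` into
itself; consequently the natural (diagonal) map `∏_{t∈T} End_{F[M]}(W t) → End_{F[N]}(V)`
is an isomorphism of `F`-algebras. -/
theorem stmt7 {F : Type*} [Field F] {M : Type*} [Group M]
    {T : Type*} [Fintype T] [DecidableEq T]
    (W : T → Type*) [∀ t, AddCommGroup (W t)] [∀ t, Module F (W t)]
    (ρ : ∀ t, M →* Module.End F (W t))
    (hfix : ∀ (t : T) (w : W t), (∀ m : M, ρ t m w = w) → w = 0) :
    (∀ s : Module.End F (∀ t, W t), s ∈ commutant F (fun m : T → M => piEnd F W ρ m) →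
      ∀ (t : T) (w : ∀ u, W u), (∀ u, u ≠ t → w u = 0) → ∀ u, u ≠ t → s w u = 0) ∧
    ∃ Ψ : (∀ t, ↥(commutant F fun m : M => ρ t m)) ≃ₐ[F]
        ↥(commutant F (fun m : T → M => piEnd F W ρ m)),
      ∀ (s : ∀ t, ↥(commutant F fun m : M => ρ t m)) (w : ∀ u, W u) (t : T),
        (Ψ s : Module.End F (∀ u, W u)) w t = (s t : Module.End F (W t)) (w t) := by
  exact ⟨fun s hs t w hw u hu => apply_eq_zero_of_mem_commutant_piEnd hfix hs (hw u hu),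
    AlgEquiv.ofBijective (commutantDiagonal ρ)
      ⟨commutantDiagonal_injective, commutantDiagonal_surjective hfix⟩,
    commutantDiagonal_apply⟩
end

section
/- Let E be a field, G a finite group acting on a finite set T, and M a finite group. Let U be a simple E[M]-module with End_{E[M]}(U) = E·id (U is absolutely simple) on which M does not act trivially (equivalently, U^M = 0). Let Ĝ = M ≀ G = (T → M) ⋊ G be the wreath product with G permuting coordinates, let N = M^T ≤ Ĝ, and let V = ⊕_{t∈T} U with Ĝ acting by (u_t)_{t∈T} · (σ, (m_t)_{t∈T}) = (u_{tσ⁻¹}·m_t)_{t∈T} (for σ ∈ G acting on T and m_t ∈ M). Then End_{E[N]}(V) is isomorphic as an E-algebra to the direct product E^T = ∏_{t∈T} E (acting by coordinatewise scalars), and under this isomorphism the conjugation action of Ĝ on End_{E[N]}(V) (s ↦ ĝ⁻¹ ∘ s ∘ ĝ, which is trivial on N) corresponds to the action of G on E^T permuting the coordinates: (z_t)_{t∈T} ↦ (z_{tσ⁻¹})_{t∈T}. -/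
/-- The action of a group `G` (acting on a set `T`) on tuples `T → M` by permuting the
coordinates. This is the action used to form the wreath product `M ≀ G = (T → M) ⋊ G`. -/
def permMulAut (M : Type*) [Group M] (G : Type*) [Group G] (T : Type*) [MulAction G T] :
    G →* MulAut (T → M) where
  toFun g :=
    { toFun := fun f t => f (g⁻¹ • t)
      invFun := fun f t => f (g • t)
      left_inv := fun f => by funext t; simp
      right_inv := fun f => by funext t; simp
      map_mul' := fun f₁ f₂ => rfl }
  map_one' := by ext f t; simp
  map_mul' g₁ g₂ := by ext f t; simp [mul_smul]

/-- The action of `T → E` on `T → U` by coordinatewise scalars, as a map of `E`-algebras. -/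
def diagonalEnd (E T U : Type*) [Field E] [AddCommGroup U] [Module E U] :
    (T → E) →ₐ[E] Module.End E (T → U) where
  toFun z := LinearMap.pi fun t => z t • LinearMap.proj t
  map_one' := by ext; simp
  map_mul' _ _ := by ext; simp [mul_smul]
  map_zero' := by ext; simp
  map_add' _ _ := by ext; simp [add_smul]
  commutes' _ := by ext; simp [Algebra.algebraMap_eq_smul_one]

@[simp]
theorem diagonalEnd_apply {E T U : Type*} [Field E] [AddCommGroup U] [Module E U]
    (z : T → E) (u : T → U) (t : T) : diagonalEnd E T U z u t = z t • u t :=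
  rfl

theorem diagonalEnd_injective {E T U : Type*} [Field E] [AddCommGroup U] [Module E U]
    [Nontrivial U] : Function.Injective (diagonalEnd E T U) := by
  intro z w h
  obtain ⟨u, hu⟩ := exists_ne (0 : U)
  funext t
  have key : diagonalEnd E T U z (fun _ => u) t = diagonalEnd E T U w (fun _ => u) t := by rw [h]
  exact smul_left_injective E hu (by simpa using key)

section Coordinatewise

variable {E T M U : Type*} [Field E] [Group M] [AddCommGroup U] [Module E U]
  {ρ : M →* Module.End E U} {ρN : (T → M) → Module.End E (T → U)}

theorem diagonalEnd_mem_commutant (hρN : ∀ f u t, ρN f u t = ρ (f t) (u t)) (z : T → E) :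
    diagonalEnd E T U z ∈ commutant E ρN := by
  intro f
  refine LinearMap.ext fun u => funext fun t => ?_
  simp [hρN]

/-- An endomorphism commuting with `M ^ T` has no off-diagonal entries when `U ^ M = 0`. -/
theorem apply_single_of_mem_commutant [DecidableEq T]
    (hρN : ∀ f u t, ρN f u t = ρ (f t) (u t))
    (hfix : ∀ u : U, (∀ m : M, ρ m u = u) → u = 0)
    {s : Module.End E (T → U)} (hs : s ∈ commutant E ρN) {t t' : T} (h : t ≠ t') (u : U) :
    s (Pi.single t' u) t = 0 := by
  refine hfix _ fun m => ?_
  have hsingle : ρN (Pi.mulSingle t m) (Pi.single t' u) = Pi.single t' u := by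
    funext r
    rw [hρN]
    rcases eq_or_ne r t with rfl | hr
    · simp [h]
    · simp [hr]
  have key := congrFun (LinearMap.congr_fun (hs (Pi.mulSingle t m)) (Pi.single t' u)) t
  simp only [Module.End.mul_apply, hsingle, hρN, Pi.mulSingle_eq_same] at key
  exact key.symm

/-- The diagonal entries of an endomorphism commuting with `M ^ T` are scalars when
`End_{E[M]}(U) = E`. -/
theorem exists_apply_single_eq_smul_of_mem_commutant [DecidableEq T]
    (hρN : ∀ f u t, ρN f u t = ρ (f t) (u t))
    (habs : ∀ s : Module.End E U, (∀ m : M, s * ρ m = ρ m * s) →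
      ∃ c : E, s = c • (1 : Module.End E U))
    {s : Module.End E (T → U)} (hs : s ∈ commutant E ρN) (t : T) :
    ∃ c : E, ∀ u : U, s (Pi.single t u) t = c • u := by
  obtain ⟨c, hc⟩ := habs (LinearMap.proj t ∘ₗ s ∘ₗ LinearMap.single E (fun _ => U) t) fun m => by
    ext u
    have hsingle : ρN (fun _ => m) (Pi.single t u) = Pi.single t (ρ m u) := by
      funext r
      rw [hρN]
      rcases eq_or_ne r t with rfl | hr
      · simp
      · simp [hr]
    have key := congrFun (LinearMap.congr_fun (hs fun _ => m) (Pi.single t u)) t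
    simp only [Module.End.mul_apply, hsingle, hρN] at key
    simpa using key
  exact ⟨c, fun u => by simpa using LinearMap.congr_fun hc u⟩

theorem exists_diagonalEnd_eq_of_mem_commutant [Finite T]
    (hρN : ∀ f u t, ρN f u t = ρ (f t) (u t))
    (habs : ∀ s : Module.End E U, (∀ m : M, s * ρ m = ρ m * s) →
      ∃ c : E, s = c • (1 : Module.End E U))
    (hfix : ∀ u : U, (∀ m : M, ρ m u = u) → u = 0)
    {s : Module.End E (T → U)} (hs : s ∈ commutant E ρN) :
    ∃ z : T → E, diagonalEnd E T U z = s := by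
  classical
  choose z hz using exists_apply_single_eq_smul_of_mem_commutant hρN habs hs
  refine ⟨z, LinearMap.pi_ext fun t' u => funext fun t => ?_⟩
  rcases eq_or_ne t t' with rfl | h
  · simp [hz]
  · simp [apply_single_of_mem_commutant hρN hfix hs h, h]

end Coordinatewise

set_option synthInstance.maxHeartbeats 1000000 in
set_option maxHeartbeats 1000000 in
/-- Let `E` be a field, `G` a finite group acting on a finite set `T`, `M` a
finite group, and `U` an (absolutely) simple `E[M]`-module with `End_{E[M]}(U) = E·id` and
`U^M = 0`.  Let `Ĝ = M ≀ G = (T → M) ⋊ G`, `N = M^T ≤ Ĝ`, and let `V = ⊕_{t∈T} U` carry the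
`Ĝ`-action `(u_t)_t · (σ, (m_t)_t) = (u_{tσ⁻¹} m_t)_t`.  Then `End_{E[N]}(V) ≅ E^T` as
`E`-algebras (with `E^T` acting by coordinatewise scalars), and under this isomorphism the
conjugation action of `Ĝ` on `End_{E[N]}(V)` corresponds to the action of `G` on `E^T`
permuting the coordinates. -/
theorem stmt10 {E : Type*} [Field E] {G T M : Type*} [Group G] [Finite G] [Fintype T]
    [MulAction G T] [Group M] [Finite M]
    {U : Type*} [AddCommGroup U] [Module E U] [Nontrivial U]
    (ρ : M →* Module.End E U)
    (hsimple : ∀ p : Submodule E U, (∀ (m : M) (u : U), u ∈ p → ρ m u ∈ p) → p = ⊥ ∨ p = ⊤)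
    (habs : ∀ s : Module.End E U, (∀ m : M, s * ρ m = ρ m * s) →
      ∃ c : E, s = c • (1 : Module.End E U))
    (hfix : ∀ u : U, (∀ m : M, ρ m u = u) → u = 0)
    (Θ : ((T → M) ⋊[permMulAut M G T] G) →* Module.End E (T → U))
    (hΘ : ∀ (f : T → M) (σ : G) (u : T → U) (t : T),
      Θ ⟨f, σ⟩ u t = ρ (f t) (u (σ⁻¹ • t))) :
    ∃ Ψ : ↥(commutant E fun m : T → M =>
          Θ ⟨m, (1 : G)⟩) ≃ₐ[E] (T → E),
      (∀ (z : T → E) (u : T → U) (t : T),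
        ((Ψ.symm z : ↥(commutant E fun m : T → M => Θ ⟨m, (1 : G)⟩)) :
            Module.End E (T → U)) u t = z t • u t) ∧
      ∀ (z : T → E) (ghat : (T → M) ⋊[permMulAut M G T] G),
        Θ ghat⁻¹ * ((Ψ.symm z : ↥(commutant E fun m : T → M => Θ ⟨m, (1 : G)⟩)) :
            Module.End E (T → U)) * Θ ghat =
          ((Ψ.symm (fun t => z (ghat.right • t)) :
              ↥(commutant E fun m : T → M => Θ ⟨m, (1 : G)⟩)) :
            Module.End E (T → U)) := by
  have hρN : ∀ (f : T → M) (u : T → U) (t : T), Θ ⟨f, (1 : G)⟩ u t = ρ (f t) (u t) := by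
    intro f u t
    simp [hΘ]
  let Φ : (T → E) →ₐ[E] ↥(commutant E fun m : T → M => Θ ⟨m, (1 : G)⟩) :=
    (diagonalEnd E T U).codRestrict _ (diagonalEnd_mem_commutant hρN)
  have hΦ : Function.Bijective Φ := by
    refine ⟨fun z w h => diagonalEnd_injective (congrArg Subtype.val h), fun s => ?_⟩
    obtain ⟨z, hz⟩ := exists_diagonalEnd_eq_of_mem_commutant hρN habs hfix s.2
    exact ⟨z, Subtype.ext hz⟩
  refine ⟨(AlgEquiv.ofBijective Φ hΦ).symm, fun _ _ _ => rfl, fun z ghat => ?_⟩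
  change Θ ghat⁻¹ * diagonalEnd E T U z * Θ ghat =
    diagonalEnd E T U fun t => z (ghat.right • t)
  have hcomm : diagonalEnd E T U z * Θ ghat =
      Θ ghat * diagonalEnd E T U fun t => z (ghat.right • t) := by
    obtain ⟨f, σ⟩ := ghat
    refine LinearMap.ext fun u => funext fun t => ?_
    simp [hΘ]
  rw [mul_assoc, hcomm, ← mul_assoc, ← map_mul, inv_mul_cancel, map_one, one_mul]
end
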